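/- arXiv:2206.02028 — 2 statements merged into one kernel-verified Lean document; each statement's English description precedes it below -/
import Mathlib

section
/- Let m ≥ 2 be an integer and n an even positive integer. If x is a C₄-face-magic Klein bottle labeling on 𝒦_{m,n} with C₄-face-magic value S, then S = 2(mn+1). -/
/-- Reduction of a (positive) index modulo `n` to a representative in `{1, …, n}`. -/
def wrap (n j : ℕ) : ℕ := if j % n = 0 then n else j % n

/-- `x` is a C₄-face-magic Klein bottle labeling of the `m × n` Klein bottle grid graph
`𝒦_{m,n}` with C₄-face-magic value `S`: `x` is a bijection from `{1,…,m} × {1,…,n}`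
onto `{1,…,m*n}` and every C₄-face of the natural embedding of `𝒦_{m,n}` in the Klein
bottle has vertex-label sum `S`. -/
def IsC4FaceMagic (m n : ℕ) (x : ℕ × ℕ → ℕ) (S : ℕ) : Prop :=
  Set.BijOn x (Set.Icc 1 m ×ˢ Set.Icc 1 n) (Set.Icc 1 (m * n)) ∧
  (∀ i j, 1 ≤ i → i + 1 ≤ m → 1 ≤ j → j ≤ n →
    x (i, j) + x (i + 1, j) + x (i, wrap n (j + 1)) + x (i + 1, wrap n (j + 1)) = S) ∧
  (∀ j, 1 ≤ j → j ≤ n →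
    x (m, j) + x (m, wrap n (j + 1)) + x (1, n + 1 - j) + x (1, wrap n (n - j)) = S)

theorem wrap_of_le {n j : ℕ} (hj : 1 ≤ j) (hjn : j ≤ n) : wrap n j = j := by
  unfold wrap
  rcases hjn.eq_or_lt with rfl | h
  · simp
  · rw [Nat.mod_eq_of_lt h, if_neg (by omega)]

theorem wrap_zero (n : ℕ) : wrap n 0 = n := by simp [wrap]

theorem wrap_succ_self {n : ℕ} (hn : 0 < n) : wrap n (n + 1) = 1 := by
  unfold wrap
  rcases (Nat.succ_le_of_lt hn).eq_or_lt with rfl | h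
  · simp
  · rw [Nat.add_mod_left, Nat.mod_eq_of_lt h, if_neg (by omega)]

/-- Cyclically shifting the indices by one preserves the sum over `{1, …, n}`. -/
theorem sum_wrap_add_two (n : ℕ) (f : ℕ → ℕ) :
    ∑ j ∈ Finset.range n, f (wrap n (j + 2)) = ∑ j ∈ Finset.range n, f (j + 1) := by
  cases n with
  | zero => simp
  | succ k =>
    rw [Finset.sum_range_succ, Finset.sum_range_succ' (fun j => f (j + 1)),
      wrap_succ_self k.succ_pos]
    congr 1
    refine Finset.sum_congr rfl fun j hj => ?_
    rw [wrap_of_le (by omega) (by have := Finset.mem_range.1 hj; omega)]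

theorem sum_sub (n : ℕ) (f : ℕ → ℕ) :
    ∑ j ∈ Finset.range n, f (n - j) = ∑ j ∈ Finset.range n, f (j + 1) := by
  rw [← Finset.sum_range_reflect]
  refine Finset.sum_congr rfl fun j hj => ?_
  have := Finset.mem_range.1 hj
  congr 1
  omega

theorem sum_wrap_sub (n : ℕ) (f : ℕ → ℕ) :
    ∑ j ∈ Finset.range n, f (wrap n (n - (j + 1))) = ∑ j ∈ Finset.range n, f (j + 1) := by
  have h : ∑ j ∈ Finset.range n, f (wrap n (n - (j + 1))) =
      ∑ j ∈ Finset.range n, f (wrap n j) := by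
    rw [← Finset.sum_range_reflect]
    refine Finset.sum_congr rfl fun j hj => ?_
    have := Finset.mem_range.1 hj
    congr 2
    omega
  rw [h]
  cases n with
  | zero => simp
  | succ k =>
    rw [Finset.sum_range_succ', Finset.sum_range_succ (fun j => f (j + 1)), wrap_zero]
    congr 1
    refine Finset.sum_congr rfl fun j hj => ?_
    rw [wrap_of_le (by omega) (by have := Finset.mem_range.1 hj; omega)]

/-- The sum of all labels of a bijective labeling of `{1, …, m} × {1, …, n}`. -/
theorem two_mul_sum_labels {m n : ℕ} {x : ℕ × ℕ → ℕ}
    (h : Set.BijOn x (Set.Icc 1 m ×ˢ Set.Icc 1 n) (Set.Icc 1 (m * n))) :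
    2 * ∑ i ∈ Finset.range m, ∑ j ∈ Finset.range n, x (i + 1, j + 1) =
      m * n * (m * n + 1) := by
  have hsum : ∑ i ∈ Finset.range m, ∑ j ∈ Finset.range n, x (i + 1, j + 1) =
      ∑ t ∈ Finset.range (m * n + 1), t := by
    rw [← Finset.sum_product', Finset.sum_range_succ' (fun t => t), add_zero]
    refine Finset.sum_bij (fun p _ => x (p.1 + 1, p.2 + 1) - 1) ?_ ?_ ?_ ?_
    · intro p hp
      simp only [Finset.mem_product, Finset.mem_range] at hp ⊢
      have := h.mapsTo (x := (p.1 + 1, p.2 + 1)) (by simp; omega)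
      simp only [Set.mem_Icc] at this
      omega
    · intro p hp q hq hpq
      simp only [Finset.mem_product, Finset.mem_range] at hp hq
      have hp' : (p.1 + 1, p.2 + 1) ∈ Set.Icc 1 m ×ˢ Set.Icc 1 n := by simp; omega
      have hq' : (q.1 + 1, q.2 + 1) ∈ Set.Icc 1 m ×ˢ Set.Icc 1 n := by simp; omega
      have h₁ := (h.mapsTo hp').1
      have h₂ := (h.mapsTo hq').1
      have := h.injOn hp' hq' (by omega)
      simp only [Prod.mk.injEq, Nat.add_right_cancel_iff] at this
      exact Prod.ext this.1 this.2
    · intro t ht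
      obtain ⟨⟨i, j⟩, hij, hx⟩ := h.surjOn (a := t + 1) (by
        have := Finset.mem_range.1 ht
        simp; omega)
      simp only [Set.mem_prod, Set.mem_Icc] at hij
      refine ⟨(i - 1, j - 1), ?_, ?_⟩
      · simp only [Finset.mem_product, Finset.mem_range]
        omega
      · simp only [Nat.sub_add_cancel hij.1.1, Nat.sub_add_cancel hij.2.1, hx]
        omega
    · intro p hp
      simp only [Finset.mem_product, Finset.mem_range] at hp
      have := h.mapsTo (x := (p.1 + 1, p.2 + 1)) (by simp; omega)
      simp only [Set.mem_Icc] at this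
      omega
  rw [hsum, mul_comm 2, Finset.sum_range_id_mul_two, Nat.add_sub_cancel, mul_comm]

/-- For `m ≥ 2` and `n` an even positive integer, the C₄-face-magic value
of any C₄-face-magic Klein bottle labeling on `𝒦_{m,n}` equals `2(mn+1)`. -/
theorem kleinBottle_magicValue (m n : ℕ) (hm : 2 ≤ m) (hn : 0 < n) (hne : Even n)
    (x : ℕ × ℕ → ℕ) (S : ℕ) (h : IsC4FaceMagic m n x S) : S = 2 * (m * n + 1) := by
  obtain ⟨hbij, hrow, htwist⟩ := h
  set R : ℕ → ℕ := fun i => ∑ j ∈ Finset.range n, x (i, j + 1) with hR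
  have hrow' : ∀ i ∈ Finset.range (m - 1), 2 * R (i + 1) + 2 * R (i + 2) = n * S := by
    intro i hi
    have hi' := Finset.mem_range.1 hi
    have hs := Finset.sum_congr rfl fun j (hj : j ∈ Finset.range n) =>
      hrow (i + 1) (j + 1) (by omega) (by omega) (by omega) (Finset.mem_range.1 hj)
    simp only [Finset.sum_add_distrib, Finset.sum_const, Finset.card_range, smul_eq_mul,
      add_assoc, Nat.reduceAdd] at hs
    rw [sum_wrap_add_two n (fun j => x (i + 1, j)),
      sum_wrap_add_two n (fun j => x (i + 2, j))] at hs
    simp only [hR]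
    omega
  have htwist' : 2 * R m + 2 * R 1 = n * S := by
    have hs := Finset.sum_congr rfl fun j (hj : j ∈ Finset.range n) =>
      htwist (j + 1) (by omega) (Finset.mem_range.1 hj)
    simp only [Finset.sum_add_distrib, Finset.sum_const, Finset.card_range, smul_eq_mul,
      add_assoc, Nat.reduceAdd, Nat.add_sub_add_right] at hs
    rw [sum_wrap_add_two n (fun j => x (m, j)), sum_sub n (fun j => x (1, j)),
      sum_wrap_sub n (fun j => x (1, j))] at hs
    simp only [hR]
    omega
  have htotal : 2 * ∑ i ∈ Finset.range m, R (i + 1) = m * n * (m * n + 1) :=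
    two_mul_sum_labels hbij
  have hfaces := Finset.sum_congr rfl hrow'
  obtain ⟨k, rfl⟩ : ∃ k, m = k + 1 := ⟨m - 1, by omega⟩
  simp only [Nat.add_sub_cancel, Finset.sum_add_distrib, ← Finset.mul_sum, Finset.sum_const,
    Finset.card_range, smul_eq_mul] at hfaces
  have hlast := Finset.sum_range_succ (fun i => R (i + 1)) k
  have hfirst := Finset.sum_range_succ' (fun i => R (i + 1)) k
  simp only [add_assoc, Nat.reduceAdd, zero_add] at hlast hfirst
  have hcount : (k + 1) * n * S = (k + 1) * n * (2 * ((k + 1) * n + 1)) := by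
    linarith
  exact Nat.eq_of_mul_eq_mul_left (by positivity) hcount
end

section
/- Let m ≥ 3 be an odd integer and k an integer with 1 ≤ k ≤ m+1. Then there exist at least (m−1)! pairwise Klein bottle nonequivalent C₄-face-magic Klein bottle labelings x on 𝒦_{m,6} satisfying x_{1,1} + x_{1,2} = 2m+k and x_{1,2} + x_{1,3} = 3m+k. -/
/-- The symmetry `U` of the Klein bottle: `U(i,j) = (i+1,j)` for `1 ≤ i ≤ m-1` and
`U(m,j) = (1, n+1-j)`. -/
def Umap (m n : ℕ) : ℕ × ℕ → ℕ × ℕ := fun p => if p.1 < m then (p.1 + 1, p.2) else (1, n + 1 - p.2)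

/-- The symmetry `H` of the Klein bottle: `H(i,j) = (i, j + n/2)`, second coordinate
taken modulo `n` with representative in `{1,…,n}`. -/
def Hmap (n : ℕ) : ℕ × ℕ → ℕ × ℕ := fun p => (p.1, wrap n (p.2 + n / 2))

/-- The reflection `F` of the Klein bottle: `F(i,j) = (i, n+1-j)`. -/
def Fmap (n : ℕ) : ℕ × ℕ → ℕ × ℕ := fun p => (p.1, n + 1 - p.2)

/-- Membership in the Klein bottle labeling symmetry group `KBLS(m,n)`, the group of
permutations of `{1,…,m} × {1,…,n}` generated by `U`, `H` and `F`. -/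
inductive MemKBLS (m n : ℕ) : (ℕ × ℕ → ℕ × ℕ) → Prop
  | one : MemKBLS m n id
  | genU : MemKBLS m n (Umap m n)
  | genH : MemKBLS m n (Hmap n)
  | genF : MemKBLS m n (Fmap n)
  | comp {f g : ℕ × ℕ → ℕ × ℕ} : MemKBLS m n f → MemKBLS m n g → MemKBLS m n (f ∘ g)

/-- Two labelings of `𝒦_{m,n}` are Klein bottle equivalent if one is obtained from the
other by composing with a member of `KBLS(m,n)`. -/
def KBEquiv (m n : ℕ) (x y : ℕ × ℕ → ℕ) : Prop :=
  ∃ A, MemKBLS m n A ∧ ∀ p ∈ Set.Icc 1 m ×ˢ Set.Icc 1 n, y p = x (A p)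

/-- The `v`-th first-column label, for `1 ≤ v ≤ m`; these labels exhaust
`{1,…,k-1} ∪ {m+k,…,2m}`. -/
def columnLabel (m k v : ℕ) : ℕ := if v < k then v else m + v

/-- The row of labels `t, 2m+k-t, m+t, 5m+1-t, 4m+1-k+t, 6m+1-t`, where `t` is the `v`-th
first-column label. -/
def rowLabel (m k v j : ℕ) : ℕ :=
  let t := columnLabel m k v
  if j = 1 then t else if j = 2 then 2 * m + k - t else if j = 3 then m + t
  else if j = 4 then 5 * m + 1 - t else if j = 5 then 4 * m + 1 - k + t else 6 * m + 1 - t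

/-- The labeling whose `i`-th row is the row with index `f i`, reversed when `i` is even. -/
def rowLabeling (m k : ℕ) (f : ℕ → ℕ) (p : ℕ × ℕ) : ℕ :=
  rowLabel m k (f p.1) (if p.1 % 2 = 1 then p.2 else 7 - p.2)

theorem columnLabel_bounds {m k v : ℕ} (hv : 1 ≤ v) (hvm : v ≤ m) :
    1 ≤ columnLabel m k v ∧ columnLabel m k v ≤ 2 * m := by
  unfold columnLabel
  split_ifs <;> omega

theorem columnLabel_injective (m k : ℕ) : Function.Injective (columnLabel m k) := by
  intro v w h
  unfold columnLabel at h
  split_ifs at h <;> omega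

theorem rowLabel_mem {m k v j : ℕ} (hk1 : 1 ≤ k) (hk2 : k ≤ m + 1)
    (hv : 1 ≤ v) (hvm : v ≤ m) (hj : 1 ≤ j) (hj6 : j ≤ 6) :
    rowLabel m k v j ∈ Set.Icc 1 (m * 6) := by
  have hlt : columnLabel m k v < 2 * m + k := by
    have := columnLabel_bounds (k := k) hv hvm
    omega
  have hb := columnLabel_bounds (k := k) hv hvm
  rw [Set.mem_Icc]
  interval_cases j <;> simp [rowLabel] <;> omega

theorem rowLabel_injective {m k v w j l : ℕ} (hk1 : 1 ≤ k) (hk2 : k ≤ m + 1)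
    (hv : 1 ≤ v) (hvm : v ≤ m) (hw : 1 ≤ w) (hwm : w ≤ m)
    (hj : 1 ≤ j) (hj6 : j ≤ 6) (hl : 1 ≤ l) (hl6 : l ≤ 6)
    (h : rowLabel m k v j = rowLabel m k w l) : v = w ∧ j = l := by
  interval_cases j <;> interval_cases l <;> simp [rowLabel, columnLabel] at h ⊢ <;>
    split_ifs at h <;> omega

theorem rowLabeling_bijOn {m k : ℕ} {f : ℕ → ℕ} (hk1 : 1 ≤ k) (hk2 : k ≤ m + 1)
    (hf : Set.MapsTo f (Set.Icc 1 m) (Set.Icc 1 m)) (hinj : Set.InjOn f (Set.Icc 1 m)) :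
    Set.BijOn (rowLabeling m k f) (Set.Icc 1 m ×ˢ Set.Icc 1 6) (Set.Icc 1 (m * 6)) := by
  have hmaps : Set.MapsTo (rowLabeling m k f) (Set.Icc 1 m ×ˢ Set.Icc 1 6)
      (Set.Icc 1 (m * 6)) := by
    rintro ⟨i, j⟩ ⟨hi, hj⟩
    have hfi := hf hi
    simp only [Set.mem_Icc] at hfi hj
    apply rowLabel_mem hk1 hk2 hfi.1 hfi.2 <;> dsimp only <;> split_ifs <;> omega
  have hinjOn : Set.InjOn (rowLabeling m k f) (Set.Icc 1 m ×ˢ Set.Icc 1 6) := by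
    rintro ⟨i, j⟩ ⟨hi, hj⟩ ⟨i', j'⟩ ⟨hi', hj'⟩ h
    have hfi := hf hi
    have hfi' := hf hi'
    simp only [Set.mem_Icc] at hfi hfi' hj hj'
    obtain ⟨hrow, hcol⟩ := rowLabel_injective hk1 hk2 hfi.1 hfi.2 hfi'.1 hfi'.2
      (by dsimp only; split_ifs <;> omega) (by dsimp only; split_ifs <;> omega)
      (by dsimp only; split_ifs <;> omega) (by dsimp only; split_ifs <;> omega) h
    obtain rfl : i = i' := hinj hi hi' hrow
    dsimp only at hcol
    have : j = j' := by split_ifs at hcol <;> omega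
    rw [this]
  refine ⟨hmaps, hinjOn, ?_⟩
  have key := Finset.surjOn_of_injOn_of_card_le (s := Finset.Icc 1 m ×ˢ Finset.Icc 1 6)
    (t := Finset.Icc 1 (m * 6)) (rowLabeling m k f)
    (by simpa using hmaps) (by simpa using hinjOn) (by simp)
  simpa using key

theorem rowLabeling_isC4FaceMagic {m k : ℕ} {f : ℕ → ℕ} (hm : Odd m)
    (hk1 : 1 ≤ k) (hk2 : k ≤ m + 1)
    (hf : Set.MapsTo f (Set.Icc 1 m) (Set.Icc 1 m)) (hinj : Set.InjOn f (Set.Icc 1 m)) :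
    IsC4FaceMagic m 6 (rowLabeling m k f) (12 * m + 2) := by
  have hmod : m % 2 = 1 := Nat.odd_iff.mp hm
  have hbound : ∀ i, 1 ≤ i → i ≤ m →
      1 ≤ columnLabel m k (f i) ∧ columnLabel m k (f i) ≤ 2 * m := fun i h1 h2 =>
    have h := hf (Set.mem_Icc.mpr ⟨h1, h2⟩)
    columnLabel_bounds h.1 h.2
  refine ⟨rowLabeling_bijOn hk1 hk2 hf hinj, ?_, ?_⟩
  · intro i j hi him hj hj6
    have h1 := hbound i hi (by omega)
    have h2 := hbound (i + 1) (by omega) him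
    rcases Nat.mod_two_eq_zero_or_one i with hpar | hpar
    · have hpar' : (i + 1) % 2 = 1 := by omega
      interval_cases j <;> simp [rowLabeling, rowLabel, wrap, hpar, hpar'] <;> omega
    · have hpar' : (i + 1) % 2 = 0 := by omega
      interval_cases j <;> simp [rowLabeling, rowLabel, wrap, hpar, hpar'] <;> omega
  · intro j hj hj6
    have h1 := hbound 1 le_rfl (by omega)
    have h2 := hbound m (by omega) le_rfl
    interval_cases j <;> simp [rowLabeling, rowLabel, wrap, hmod] <;> omega

theorem MemKBLS.mapsTo {m : ℕ} {A : ℕ × ℕ → ℕ × ℕ} (hA : MemKBLS m 6 A) :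
    Set.MapsTo A (Set.Icc 1 m ×ˢ Set.Icc 1 6) (Set.Icc 1 m ×ˢ Set.Icc 1 6) := by
  induction hA with
  | one => exact Set.mapsTo_id _
  | genU =>
    rintro ⟨i, j⟩ h
    simp only [Set.mem_prod, Set.mem_Icc, Umap] at h ⊢
    split_ifs <;> dsimp only <;> omega
  | genH =>
    rintro ⟨i, j⟩ h
    simp only [Set.mem_prod, Set.mem_Icc, Hmap, wrap] at h ⊢
    split_ifs <;> omega
  | genF =>
    rintro ⟨i, j⟩ h
    simp only [Set.mem_prod, Set.mem_Icc, Fmap] at h ⊢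
    omega
  | comp _ _ hf hg => exact hf.comp hg

theorem MemKBLS.comm_Umap {m : ℕ} {A : ℕ × ℕ → ℕ × ℕ} (hA : MemKBLS m 6 A)
    {p : ℕ × ℕ} (hp : p ∈ Set.Icc 1 m ×ˢ Set.Icc 1 6) :
    A (Umap m 6 p) = Umap m 6 (A p) := by
  induction hA generalizing p with
  | one => rfl
  | genU => rfl
  | genH =>
    obtain ⟨i, j⟩ := p
    simp only [Set.mem_prod, Set.mem_Icc] at hp
    obtain ⟨-, hj, hj6⟩ := hp
    by_cases him : i < m <;> interval_cases j <;> simp [Hmap, Umap, wrap, him]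
  | genF =>
    by_cases him : p.1 < m <;> simp [Fmap, Umap, him]
  | comp hf hg ihf ihg =>
    simp only [Function.comp_apply]
    rw [ihg hp, ihf (hg.mapsTo hp)]

theorem MemKBLS.fixes_first_column {m : ℕ} {A : ℕ × ℕ → ℕ × ℕ} (hA : MemKBLS m 6 A)
    (h : A (1, 1) = (1, 1)) {i : ℕ} (hi : 1 ≤ i) (him : i ≤ m) : A (i, 1) = (i, 1) := by
  induction i, hi using Nat.le_induction with
  | base => exact h
  | succ i hi ih =>
    have hU : Umap m 6 (i, 1) = (i + 1, 1) := by simp [Umap, Nat.lt_of_succ_le him]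
    rw [← hU, hA.comm_Umap (by simp; omega), ih (by omega)]

theorem rowLabeling_eqOn_of_KBEquiv {m k : ℕ} {f g : ℕ → ℕ} (hm : 1 ≤ m)
    (hk1 : 1 ≤ k) (hk2 : k ≤ m + 1)
    (hf : Set.MapsTo f (Set.Icc 1 m) (Set.Icc 1 m)) (hfi : Set.InjOn f (Set.Icc 1 m))
    (hg : Set.MapsTo g (Set.Icc 1 m) (Set.Icc 1 m)) (hfg : f 1 = g 1)
    (h : KBEquiv m 6 (rowLabeling m k f) (rowLabeling m k g)) :
    Set.EqOn f g (Set.Icc 1 m) := by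
  obtain ⟨A, hA, hAp⟩ := h
  have h11 : ((1, 1) : ℕ × ℕ) ∈ Set.Icc 1 m ×ˢ Set.Icc 1 6 := by simp [hm]
  have hfix : A (1, 1) = (1, 1) := by
    apply (rowLabeling_bijOn hk1 hk2 hf hfi).injOn (hA.mapsTo h11) h11
    rw [← hAp _ h11]
    simp [rowLabeling, hfg]
  intro i hi
  have hcol := hAp (i, 1) ⟨hi, by simp⟩
  rw [hA.fixes_first_column hfix hi.1 hi.2] at hcol
  have hgi := hg hi
  have hfi' := hf hi
  have hj : 1 ≤ (if i % 2 = 1 then 1 else 7 - 1) ∧ (if i % 2 = 1 then 1 else 7 - 1) ≤ 6 := by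
    split_ifs <;> omega
  exact (rowLabel_injective hk1 hk2 hgi.1 hgi.2 hfi'.1 hfi'.2 hj.1 hj.2 hj.1 hj.2 hcol).1.symm

/-- The permutation of `{1,…,n+1}` fixing `1` and induced by `τ` on the other points. -/
def fixOnePerm {n : ℕ} (τ : Equiv.Perm (Fin n)) (i : ℕ) : ℕ :=
  (Equiv.Perm.decomposeFin.symm (0, τ) (Fin.ofNat (n + 1) (i - 1)) : ℕ) + 1

theorem fixOnePerm_one {n : ℕ} (τ : Equiv.Perm (Fin n)) : fixOnePerm τ 1 = 1 := by
  simp [fixOnePerm]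

theorem fixOnePerm_mapsTo {n : ℕ} (τ : Equiv.Perm (Fin n)) :
    Set.MapsTo (fixOnePerm τ) (Set.Icc 1 (n + 1)) (Set.Icc 1 (n + 1)) := by
  intro i _
  rw [Set.mem_Icc, fixOnePerm]
  omega

theorem fixOnePerm_injOn {n : ℕ} (τ : Equiv.Perm (Fin n)) :
    Set.InjOn (fixOnePerm τ) (Set.Icc 1 (n + 1)) := by
  intro i hi j hj h
  have h' := (Equiv.injective _) (Fin.val_injective (Nat.succ_injective h))
  have h'' := congrArg Fin.val h'
  simp only [Set.mem_Icc] at hi hj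
  simp only [Fin.val_ofNat] at h''
  rw [Nat.mod_eq_of_lt (by omega), Nat.mod_eq_of_lt (by omega)] at h''
  omega

theorem eq_of_fixOnePerm_eqOn {n : ℕ} {τ υ : Equiv.Perm (Fin n)}
    (h : Set.EqOn (fixOnePerm τ) (fixOnePerm υ) (Set.Icc 1 (n + 1))) : τ = υ := by
  have hdec : Equiv.Perm.decomposeFin.symm ((0 : Fin (n + 1)), τ) =
      Equiv.Perm.decomposeFin.symm (0, υ) := by
    ext a
    have ha := h (x := a + 1) (by rw [Set.mem_Icc]; omega)
    simpa only [fixOnePerm, Nat.add_sub_cancel, Fin.ofNat_val_eq_self, Nat.add_right_cancel_iff]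
      using ha
  exact congrArg Prod.snd (Equiv.Perm.decomposeFin.symm.injective hdec)

/-- For `m ≥ 3` odd and `1 ≤ k ≤ m+1`, there are at least `(m-1)!`
pairwise Klein bottle nonequivalent C₄-face-magic Klein bottle labelings `x` on `𝒦_{m,6}`
with `x_{1,1} + x_{1,2} = 2m+k` and `x_{1,2} + x_{1,3} = 3m+k`. -/
theorem kleinBottle_m6_diagonal (m k : ℕ) (hm : 3 ≤ m) (hmo : Odd m)
    (hk1 : 1 ≤ k) (hk2 : k ≤ m + 1) :
    ∃ T : Finset (ℕ × ℕ → ℕ),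
      Nat.factorial (m - 1) ≤ T.card ∧
      (∀ x ∈ T, (∃ S, IsC4FaceMagic m 6 x S) ∧
        x (1, 1) + x (1, 2) = 2 * m + k ∧ x (1, 2) + x (1, 3) = 3 * m + k) ∧
      (∀ x ∈ T, ∀ y ∈ T, x ≠ y → ¬ KBEquiv m 6 x y) := by
  obtain ⟨n, rfl⟩ : ∃ n, m = n + 1 := ⟨m - 1, by omega⟩
  have hequiv : ∀ τ υ : Equiv.Perm (Fin n),
      KBEquiv (n + 1) 6 (rowLabeling (n + 1) k (fixOnePerm τ))
        (rowLabeling (n + 1) k (fixOnePerm υ)) → τ = υ := fun τ υ h =>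
    eq_of_fixOnePerm_eqOn <| rowLabeling_eqOn_of_KBEquiv (by omega) hk1 hk2
      (fixOnePerm_mapsTo τ) (fixOnePerm_injOn τ) (fixOnePerm_mapsTo υ)
      (by rw [fixOnePerm_one, fixOnePerm_one]) h
  refine ⟨Finset.univ.map ⟨fun τ : Equiv.Perm (Fin n) =>
    rowLabeling (n + 1) k (fixOnePerm τ), fun τ υ h => ?_⟩, ?_, ?_, ?_⟩
  · exact hequiv τ υ ⟨id, .one, fun p _ => (congrFun h p).symm⟩
  · simp [Fintype.card_perm]
  · intro x hx
    obtain ⟨τ, -, rfl⟩ := Finset.mem_map.mp hx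
    refine ⟨⟨_, rowLabeling_isC4FaceMagic hmo hk1 hk2 (fixOnePerm_mapsTo τ)
      (fixOnePerm_injOn τ)⟩, ?_⟩
    have hb := columnLabel_bounds (m := n + 1) (k := k) le_rfl (by omega)
    change rowLabeling (n + 1) k (fixOnePerm τ) (1, 1) + rowLabeling (n + 1) k (fixOnePerm τ) (1, 2)
      = _ ∧ rowLabeling (n + 1) k (fixOnePerm τ) (1, 2) + rowLabeling (n + 1) k (fixOnePerm τ) (1, 3)
      = _
    simp [rowLabeling, fixOnePerm_one, rowLabel]
    omega
  · intro x hx y hy hxy h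
    obtain ⟨τ, -, rfl⟩ := Finset.mem_map.mp hx
    obtain ⟨υ, -, rfl⟩ := Finset.mem_map.mp hy
    exact hxy (congrArg _ (hequiv τ υ h))
end
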